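/- Let n ≥ 4 and 2 ≤ k with 2k < n, and let G = C_n^k be the k-th power of the cycle on n vertices. Then G is gap-vertex-labelable if and only if (n = 6 and k = 2), or (n = 7 and k = 2), or (n ≥ 8 and 4k ≤ n). -/

import Mathlib

/-- The neighbourhood of `v` in `G` as a `Finset` (classically decidable). -/
noncomputable def gapNbhd {V : Type*} [Fintype V] (G : SimpleGraph V) (v : V) : Finset V :=
  @Finset.filter V (fun u => G.Adj v u) (Classical.decPred _) Finset.univ

/-- The colouring induced by a vertex-labelling `π` : a vertex with at least two neighbours
gets the gap `max − min` of the labels of its neighbours, a vertex with exactly one neighbour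
`u` gets `π u`, and an isolated vertex gets `1`. -/
noncomputable def gapColor {V : Type*} [Fintype V] (G : SimpleGraph V) (π : V → ℕ) (v : V) : ℕ :=
  if h : ((gapNbhd G v).image π).Nonempty then
    if 2 ≤ (gapNbhd G v).card then
      ((gapNbhd G v).image π).max' h - ((gapNbhd G v).image π).min' h
    else ((gapNbhd G v).image π).max' h
  else 1

/-- `π` is a gap-`[k]`-vertex-labelling of `G`: the labels lie in `{1, …, k}` and the induced
colouring is proper. -/
def IsGapLabelling {V : Type*} [Fintype V] (G : SimpleGraph V) (k : ℕ) (π : V → ℕ) : Prop :=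
  (∀ v, 1 ≤ π v ∧ π v ≤ k) ∧
  ∀ u v, G.Adj u v → gapColor G π u ≠ gapColor G π v

/-- `G` is gap-vertex-labelable if it admits a gap-`[k]`-vertex-labelling for some `k ≥ 1`. -/
def GapVertexLabelable {V : Type*} [Fintype V] (G : SimpleGraph V) : Prop :=
  ∃ k, 1 ≤ k ∧ ∃ π, IsGapLabelling G k π

/-- The vertex-gap number: the least `k ≥ 1` for which `G` admits a
gap-`[k]`-vertex-labelling. -/
noncomputable def vertexGapNumber {V : Type*} [Fintype V] (G : SimpleGraph V) : ℕ :=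
  sInf {k | 1 ≤ k ∧ ∃ π, IsGapLabelling G k π}

/-- The `k`-th power of the cycle on `n` vertices: vertices `0, …, n − 1` (cyclically), with
distinct `i`, `j` adjacent iff their cyclic distance `min (|i − j|, n − |i − j|)` is at most
`k`. -/
def cyclePower (n k : ℕ) : SimpleGraph (Fin n) :=
  SimpleGraph.fromRel
    (fun i j => i.val ≤ j.val ∧ (j.val - i.val ≤ k ∨ n - (j.val - i.val) ≤ k))

theorem cyclePower_adj_iff {n k : ℕ} {i j : Fin n} :
    (cyclePower n k).Adj i j ↔ i ≠ j ∧
      ((i.val ≤ j.val ∧ (j.val - i.val ≤ k ∨ n - (j.val - i.val) ≤ k)) ∨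
        (j.val ≤ i.val ∧ (i.val - j.val ≤ k ∨ n - (i.val - j.val) ≤ k))) := by
  simp [cyclePower]

instance (n k : ℕ) : DecidableRel (cyclePower n k).Adj := fun _ _ =>
  decidable_of_iff _ cyclePower_adj_iff.symm

section Gap

variable {V : Type*} [Fintype V] {G : SimpleGraph V} {π : V → ℕ} {u v : V}

theorem mem_gapNbhd : u ∈ gapNbhd G v ↔ G.Adj v u := by
  simp [gapNbhd]

theorem gapColor_eq_sub {x y : V} (hx : G.Adj v x) (hy : G.Adj v y) (hxy : x ≠ y)
    (h : ∀ z, G.Adj v z → π y ≤ π z ∧ π z ≤ π x) : gapColor G π v = π x - π y := by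
  have hx' : π x ∈ (gapNbhd G v).image π := Finset.mem_image_of_mem π (mem_gapNbhd.2 hx)
  have hy' : π y ∈ (gapNbhd G v).image π := Finset.mem_image_of_mem π (mem_gapNbhd.2 hy)
  have hcard : 2 ≤ (gapNbhd G v).card :=
    Finset.one_lt_card.2 ⟨x, mem_gapNbhd.2 hx, y, mem_gapNbhd.2 hy, hxy⟩
  have hmax : ((gapNbhd G v).image π).max' ⟨_, hx'⟩ = π x := by
    refine le_antisymm (Finset.max'_le _ _ _ ?_) (Finset.le_max' _ _ hx')
    simp only [Finset.mem_image, mem_gapNbhd]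
    rintro _ ⟨z, hz, rfl⟩
    exact (h z hz).2
  have hmin : ((gapNbhd G v).image π).min' ⟨_, hx'⟩ = π y := by
    refine le_antisymm (Finset.min'_le _ _ hy') (Finset.le_min' _ _ _ ?_)
    simp only [Finset.mem_image, mem_gapNbhd]
    rintro _ ⟨z, hz, rfl⟩
    exact (h z hz).1
  rw [gapColor, dif_pos ⟨_, hx'⟩, if_pos hcard, hmax, hmin]

/-- To show that a graph is labelable it suffices to give a labelling together with, for each
vertex, neighbours of largest and of smallest label. -/
theorem gapVertexLabelable_of_extremal (π : V → ℕ) (X Y : V → V) (hπ : ∀ v, 1 ≤ π v)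
    (hX : ∀ v, G.Adj v (X v)) (hY : ∀ v, G.Adj v (Y v)) (hXY : ∀ v, X v ≠ Y v)
    (hext : ∀ v z, G.Adj v z → π (Y v) ≤ π z ∧ π z ≤ π (X v))
    (hne : ∀ u v, G.Adj u v → π (X u) - π (Y u) ≠ π (X v) - π (Y v)) :
    GapVertexLabelable G := by
  refine ⟨Finset.univ.sup π + 1, by omega, π, fun v => ⟨hπ v, ?_⟩, fun u v huv => ?_⟩
  · exact (Finset.le_sup (f := π) (Finset.mem_univ v)).trans (Nat.le_succ _)
  · rw [gapColor_eq_sub (hX u) (hY u) (hXY u) (hext u),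
      gapColor_eq_sub (hX v) (hY v) (hXY v) (hext v)]
    exact hne u v huv

/-- A graph in which any two distinct vertices have two adjacent common neighbours
is not labelable. -/
theorem not_gapVertexLabelable_of_common_adj [Nontrivial V]
    (h : ∀ a b : V, a ≠ b → ∃ u w, G.Adj u w ∧ G.Adj u a ∧ G.Adj u b ∧ G.Adj w a ∧ G.Adj w b) :
    ¬ GapVertexLabelable G := by
  rintro ⟨-, -, π, -, hcol⟩
  obtain ⟨a, ha⟩ := Finite.exists_max π
  obtain ⟨b, hb⟩ := Finite.exists_min π
  by_cases hab : a = b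
  · subst hab
    obtain ⟨c, hc⟩ := exists_ne a
    obtain ⟨u, w, huw, hua, huc, hwa, hwc⟩ := h a c hc.symm
    have hac : ∀ z, π c ≤ π z ∧ π z ≤ π a := fun z => ⟨(ha c).trans (hb z), ha z⟩
    exact hcol u w huw <| (gapColor_eq_sub hua huc hc.symm fun z _ => hac z).trans
      (gapColor_eq_sub hwa hwc hc.symm fun z _ => hac z).symm
  · obtain ⟨u, w, huw, hua, hub, hwa, hwb⟩ := h a b hab
    exact hcol u w huw <| (gapColor_eq_sub hua hub hab fun z _ => ⟨hb z, ha z⟩).trans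
      (gapColor_eq_sub hwa hwb hab fun z _ => ⟨hb z, ha z⟩).symm

end Gap

/-- The vertex of the cycle on `n` vertices represented by an integer. -/
def cycleVertex (n : ℕ) [NeZero n] (z : ℤ) : Fin n :=
  ⟨(z % n).toNat, by
    have hn : (0 : ℤ) < n := by exact_mod_cast NeZero.pos n
    have := Int.emod_lt_of_pos z hn
    have := Int.emod_nonneg z hn.ne'
    omega⟩

theorem cycleVertex_val {n : ℕ} [NeZero n] (i : Fin n) : cycleVertex n i.val = i := by
  ext
  have := Int.emod_eq_of_lt (Int.natCast_nonneg i.val) (Int.ofNat_lt.2 i.isLt)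
  simp only [cycleVertex]
  omega

theorem cycleVertex_add_self {n : ℕ} [NeZero n] (z : ℤ) :
    cycleVertex n (z + n) = cycleVertex n z := by
  simp [cycleVertex]

theorem cyclePower_adj_cycleVertex {n k : ℕ} [NeZero n] (hkn : 2 * k < n) {s t : ℤ}
    (hne : s ≠ t) (hst : s - t ≤ k) (hts : t - s ≤ k) :
    (cyclePower n k).Adj (cycleVertex n s) (cycleVertex n t) := by
  have hn : (0 : ℤ) < n := by exact_mod_cast NeZero.pos n
  have hs := Int.emod_lt_of_pos s hn
  have hs' := Int.emod_nonneg s hn.ne'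
  have ht := Int.emod_lt_of_pos t hn
  have ht' := Int.emod_nonneg t hn.ne'
  have hds := Int.emod_add_mul_ediv s n
  have hdt := Int.emod_add_mul_ediv t n
  have hd : (n : ℤ) * (s / n) = n * (t / n) ∨ (n : ℤ) * (s / n) = n * (t / n) + n ∨
      (n : ℤ) * (s / n) + n = n * (t / n) := by
    have h1 : s / n - t / n < 2 := by
      by_contra! h
      nlinarith
    have h2 : t / n - s / n < 2 := by
      by_contra! h
      nlinarith
    obtain h | h | h : s / n = t / n ∨ s / n = t / n + 1 ∨ t / n = s / n + 1 := by omega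
    · exact .inl (by rw [h])
    · exact .inr (.inl (by rw [h]; ring))
    · exact .inr (.inr (by rw [h]; ring))
  rw [cyclePower_adj_iff, Ne, Fin.ext_iff]
  simp only [cycleVertex]
  omega

/-- If `n < 4k`, any two distinct vertices of `C_n^k` have two adjacent common neighbours, unless
`k = 2` and `n ∈ {6, 7}`. -/
theorem exists_common_adj_cyclePower {n k : ℕ} [NeZero n] (hk : 2 ≤ k) (hkn : 2 * k < n)
    (hn : n < 4 * k) (h6 : ¬ (n = 6 ∧ k = 2)) (h7 : ¬ (n = 7 ∧ k = 2)) (a b : Fin n)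
    (hab : a ≠ b) : ∃ u w, (cyclePower n k).Adj u w ∧ (cyclePower n k).Adj u a ∧
      (cyclePower n k).Adj u b ∧ (cyclePower n k).Adj w a ∧ (cyclePower n k).Adj w b := by
  by_cases h5 : k = 2
  · obtain rfl : n = 5 := by omega
    subst h5
    revert a b
    decide
  have key : ∀ s d : ℤ, 1 ≤ d → 2 * d ≤ n → ∃ u w, (cyclePower n k).Adj u w ∧
      (cyclePower n k).Adj u (cycleVertex n s) ∧ (cyclePower n k).Adj u (cycleVertex n (s + d)) ∧
      (cyclePower n k).Adj w (cycleVertex n s) ∧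
      (cyclePower n k).Adj w (cycleVertex n (s + d)) := by
    intro s d hd hdn
    have of_offsets : ∀ p q : ℤ, p ≠ q → p - q ≤ k → q - p ≤ k → p ≠ 0 → p ≠ d → q ≠ 0 → q ≠ d →
        p ≤ k → q ≤ k → d - k ≤ p → d - k ≤ q → -k ≤ p → -k ≤ q → p ≤ d + k → q ≤ d + k →
        ∃ u w, (cyclePower n k).Adj u w ∧
        (cyclePower n k).Adj u (cycleVertex n s) ∧
        (cyclePower n k).Adj u (cycleVertex n (s + d)) ∧
        (cyclePower n k).Adj w (cycleVertex n s) ∧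
        (cyclePower n k).Adj w (cycleVertex n (s + d)) := by
      intro p q _ _ _ _ _ _ _ _ _ _ _ _ _ _ _
      refine ⟨cycleVertex n (s + p), cycleVertex n (s + q), ?_, ?_, ?_, ?_, ?_⟩ <;>
        apply cyclePower_adj_cycleVertex hkn <;> omega
    by_cases h1 : d = k - 1 ∨ d = k
    · by_cases h2 : d = k
      · apply of_offsets 1 2 <;> omega
      · apply of_offsets 1 k <;> omega
    · apply of_offsets (k - 1) k <;> omega
  have of_lt : ∀ a b : Fin n, a.val < b.val → ∃ u w, (cyclePower n k).Adj u w ∧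
      (cyclePower n k).Adj u a ∧ (cyclePower n k).Adj u b ∧
      (cyclePower n k).Adj w a ∧ (cyclePower n k).Adj w b := by
    intro a b hlt
    by_cases h : 2 * (b.val - a.val) ≤ n
    · have := key a.val (b.val - a.val) (by omega) (by omega)
      rwa [add_sub_cancel, cycleVertex_val, cycleVertex_val] at this
    · obtain ⟨u, w, huw, hub, hua, hwb, hwa⟩ :=
        key b.val (a.val + n - b.val) (by omega) (by omega)
      rw [add_sub_cancel, cycleVertex_add_self, cycleVertex_val] at hua hwa
      rw [cycleVertex_val] at hub hwb
      exact ⟨u, w, huw, hua, hub, hwa, hwb⟩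
  obtain h | h := Nat.lt_or_gt_of_ne (Fin.val_ne_of_ne hab)
  · exact of_lt a b h
  · obtain ⟨u, w, huw, hub, hua, hwb, hwa⟩ := of_lt b a h
    exact ⟨u, w, huw, hua, hub, hwa, hwb⟩

theorem two_pow_sub_two_pow_inj {a b c d : ℕ} (hab : b < a) (hcd : d < c)
    (h : 2 ^ a - 2 ^ b = 2 ^ c - 2 ^ d) : a = c ∧ b = d := by
  have le_of_eq : ∀ {a b c d : ℕ}, b < a → d < c → 2 ^ a - 2 ^ b = 2 ^ c - 2 ^ d → a ≤ c := by
    intro a b c d hab hcd h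
    by_contra! hlt
    have h1 : 2 ^ (c + 1) ≤ 2 ^ a := Nat.pow_le_pow_right two_pos hlt
    have h2 : 2 ^ (b + 1) ≤ 2 ^ a := Nat.pow_le_pow_right two_pos hab
    have h3 : 2 ^ d < 2 ^ c := Nat.pow_lt_pow_right one_lt_two hcd
    have h4 : 0 < 2 ^ d := by positivity
    rw [pow_succ] at h1 h2
    omega
  obtain rfl : a = c := le_antisymm (le_of_eq hab hcd h) (le_of_eq hcd hab h.symm)
  have h1 : 2 ^ b < 2 ^ a := Nat.pow_lt_pow_right one_lt_two hab
  have h2 : 2 ^ d < 2 ^ a := Nat.pow_lt_pow_right one_lt_two hcd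
  exact ⟨rfl, Nat.pow_right_injective le_rfl (show 2 ^ b = 2 ^ d by omega)⟩

/-- A ranking of the vertices of the cycle on `n` vertices that increases on both sides from
vertex `0` to the opposite vertex. -/
def cycleRank (n i : ℕ) : ℕ := if 2 * i ≤ n then 2 * i - 1 else 2 * (n - i)

theorem cycleRank_inj {n i j : ℕ} (hi : i < n) (hj : j < n)
    (h : cycleRank n i = cycleRank n j) : i = j := by
  unfold cycleRank at h
  split_ifs at h <;> omega

theorem eq_zero_of_cycleRank_le {n i : ℕ} (hi : i < n)
    (h : ∀ j < n, (j + 1 = i ∨ j = i + 1 ∨ (j = 0 ∧ i + 1 = n)) → cycleRank n i ≤ cycleRank n j) :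
    i = 0 := by
  by_contra h0
  by_cases h1 : 2 * i ≤ n
  · have := h (i - 1) (by omega) (by omega)
    unfold cycleRank at this
    split_ifs at this <;> omega
  · by_cases h2 : i + 1 = n
    · have := h 0 (by omega) (by omega)
      unfold cycleRank at this
      split_ifs at this <;> omega
    · have := h (i + 1) (by omega) (by omega)
      unfold cycleRank at this
      split_ifs at this <;> omega

theorem eq_half_of_cycleRank_ge {n i : ℕ} (hn : 2 ≤ n) (hi : i < n)
    (h : ∀ j < n, (j + 1 = i ∨ j = i + 1) → cycleRank n j ≤ cycleRank n i) :
    i = (n + 1) / 2 := by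
  by_contra h0
  by_cases h1 : 2 * i < n
  · have := h (i + 1) (by omega) (by omega)
    unfold cycleRank at this
    split_ifs at this <;> omega
  · have := h (i - 1) (by omega) (by omega)
    unfold cycleRank at this
    split_ifs at this <;> omega

theorem gapVertexLabelable_cyclePower {n k : ℕ} (hk : 2 ≤ k) (hn : 4 * k ≤ n) :
    GapVertexLabelable (cyclePower n k) := by
  have : NeZero n := ⟨by omega⟩
  let ρ : Fin n → ℕ := fun i => cycleRank n i.val
  have hρ : Function.Injective ρ := fun i j h => Fin.ext (cycleRank_inj i.isLt j.isLt h)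
  have hadj : ∀ v : Fin n, ∃ a b, (cyclePower n k).Adj v a ∧ (cyclePower n k).Adj v b ∧
      a ≠ b := by
    intro v
    have h1 : (cyclePower n k).Adj (cycleVertex n v.val) (cycleVertex n (v.val + 1)) :=
      cyclePower_adj_cycleVertex (by omega) (by omega) (by omega) (by omega)
    have h2 : (cyclePower n k).Adj (cycleVertex n v.val) (cycleVertex n (v.val + 2)) :=
      cyclePower_adj_cycleVertex (by omega) (by omega) (by omega) (by omega)
    have h3 : (cyclePower n k).Adj (cycleVertex n (v.val + 1)) (cycleVertex n (v.val + 2)) :=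
      cyclePower_adj_cycleVertex (by omega) (by omega) (by omega) (by omega)
    rw [cycleVertex_val] at h1 h2
    exact ⟨_, _, h1, h2, h3.ne⟩
  have hX : ∀ v : Fin n, ∃ x, (cyclePower n k).Adj v x ∧
      ∀ z, (cyclePower n k).Adj v z → ρ z ≤ ρ x := by
    intro v
    obtain ⟨a, _, ha, _⟩ := hadj v
    obtain ⟨x, hx, hmax⟩ :=
      (gapNbhd (cyclePower n k) v).exists_max_image ρ ⟨a, mem_gapNbhd.2 ha⟩
    exact ⟨x, mem_gapNbhd.1 hx, fun z hz => hmax z (mem_gapNbhd.2 hz)⟩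
  have hY : ∀ v : Fin n, ∃ y, (cyclePower n k).Adj v y ∧
      ∀ z, (cyclePower n k).Adj v z → ρ y ≤ ρ z := by
    intro v
    obtain ⟨a, _, ha, _⟩ := hadj v
    obtain ⟨x, hx, hmin⟩ :=
      (gapNbhd (cyclePower n k) v).exists_min_image ρ ⟨a, mem_gapNbhd.2 ha⟩
    exact ⟨x, mem_gapNbhd.1 hx, fun z hz => hmin z (mem_gapNbhd.2 hz)⟩
  choose X hvX hX using hX
  choose Y hvY hY using hY
  have hlt : ∀ v, ρ (Y v) < ρ (X v) := by
    intro v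
    obtain ⟨a, b, ha, hb, hab⟩ := hadj v
    have hne := hρ.ne hab
    have := hX v a ha
    have := hX v b hb
    have := hY v a ha
    have := hY v b hb
    omega
  refine gapVertexLabelable_of_extremal (fun v => 2 ^ ρ v) X Y (fun v => Nat.one_le_two_pow)
    hvX hvY (fun v h => (hlt v).ne (by rw [h])) (fun v z hz => ⟨?_, ?_⟩) fun u v huv heq => ?_
  · exact Nat.pow_le_pow_right two_pos (hY v z hz)
  · exact Nat.pow_le_pow_right two_pos (hX v z hz)
  obtain ⟨hXX, hYY⟩ := two_pow_sub_two_pow_inj (hlt u) (hlt v) heq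
  replace hXX := hρ hXX
  replace hYY := hρ hYY
  have hux := hvX u
  have hvx := hvX v
  have huy := hvY u
  have hvy := hvY v
  rw [← hXX] at hvx
  rw [← hYY] at hvy
  have near : ∀ x z : Fin n, (cyclePower n k).Adj u x → (cyclePower n k).Adj v x →
      (z.val + 1 = x.val ∨ z.val = x.val + 1 ∨ (z.val = 0 ∧ x.val + 1 = n)) →
      (cyclePower n k).Adj u z ∨ (cyclePower n k).Adj v z := by
    intro x z hx hx' hz
    simp only [cyclePower_adj_iff, ne_eq, Fin.ext_iff] at hx hx' huv ⊢
    omega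
  have hx : (X u).val = (n + 1) / 2 := by
    refine eq_half_of_cycleRank_ge (by omega) (X u).isLt fun j hj hjx => ?_
    obtain h | h := near (X u) ⟨j, hj⟩ hux hvx (by simp only; omega)
    · exact hX u _ h
    · exact (hX v _ h).trans_eq (by rw [hXX])
  have hy : (Y u).val = 0 := by
    refine eq_zero_of_cycleRank_le (Y u).isLt fun j hj hjy => ?_
    obtain h | h := near (Y u) ⟨j, hj⟩ huy hvy hjy
    · exact hY u _ h
    · exact (by rw [hYY] : ρ (Y u) = ρ (Y v)).trans_le (hY v _ h)
  simp only [cyclePower_adj_iff, ne_eq, Fin.ext_iff, hx, hy] at hux hvx huy hvy huv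
  omega

/-- For `n ≥ 4` and `2 ≤ k` with `2k < n`, the power of a cycle `C_n^k` is gap-vertex-labelable
iff `(n = 6 ∧ k = 2)`, `(n = 7 ∧ k = 2)`, or `n ≥ 8` and `4k ≤ n`. -/
theorem cyclePower_gapVertexLabelable_iff (n k : ℕ) (hn : 4 ≤ n) (hk : 2 ≤ k)
    (hkn : 2 * k < n) :
    GapVertexLabelable (cyclePower n k) ↔
      (n = 6 ∧ k = 2) ∨ (n = 7 ∧ k = 2) ∨ (8 ≤ n ∧ 4 * k ≤ n) := by
  constructor
  · intro h
    have : NeZero n := ⟨by omega⟩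
    by_contra hcon
    have : Nontrivial (Fin n) := Fin.nontrivial_iff_two_le.2 (by omega)
    exact not_gapVertexLabelable_of_common_adj
      (exists_common_adj_cyclePower hk hkn (by omega) (by omega) (by omega)) h
  · rintro (⟨rfl, rfl⟩ | ⟨rfl, rfl⟩ | ⟨-, h⟩)
    · exact gapVertexLabelable_of_extremal (V := Fin 6) ![1, 2, 2, 1, 2, 4]
        ![5, 5, 1, 5, 5, 4] ![4, 0, 0, 1, 3, 3]
        (by decide) (by decide) (by decide) (by decide) (by decide) (by decide)
    · exact gapVertexLabelable_of_extremal (V := Fin 7) ![1, 2, 2, 2, 2, 2, 4]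
        ![6, 6, 1, 1, 6, 6, 4] ![5, 0, 0, 2, 2, 0, 0]
        (by decide) (by decide) (by decide) (by decide) (by decide) (by decide)
    · exact gapVertexLabelable_cyclePower hk h
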